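/- arXiv:2301.09818 — 2 statements merged into one kernel-verified Lean document; each statement's English description precedes it below -/
import Mathlib

section
/- Let u₀ ∈ M and let {u_n} be the iterates of the a₀-scheme starting at u₀. Then there exist constants C_u, C_g, and C_α ≤ 1, depending only on Ω, d, β, V, and ‖u₀‖_{H^1_0(Ω)}, such that whenever the stepsizes satisfy 0 < α_min ≤ α_n ≤ α_max ≤ C_α for all n ≥ 0, the following hold for every n ≥ 0: (i) ‖u_n‖_{a₀(Ω)} ≤ C_u; (ii) ‖∇^R_{a₀}E(u_n)‖_{a₀(Ω)} ≤ ‖∇_{a₀}E(u_n)‖_{a₀(Ω)} ≤ C_g; (iii) E(u_n) − E(u_{n+1}) ≥ (α_min/2)·‖∇^R_{a₀}E(u_n)‖²_{a₀(Ω)}. -/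
open scoped RealInnerProductSpace
open Filter Topology

/-- Abstract setting for the Gross–Pitaevskii eigenvalue problem on a bounded
Lipschitz domain `Ω ⊆ ℝᵈ` (`d ∈ {1,2,3}`) with potential `0 ≤ V ≤ Vmax` in
`L^∞(Ω)` and interaction parameter `β ≥ 0`.

The Hilbert space `H` plays the role of `H¹₀(Ω)` equipped with the inner product
`(z,w)_{H¹₀} = (∇z,∇w)_{L²}`; `P z w` is the `L²(Ω)` inner product `∫ z w`,
`Vf z w = ∫ V z w`, and `Q4 a b c d = ∫ a b c d` (defined on `H` thanks to the
Sobolev embedding `H¹₀ ↪ L⁴` valid for `d ≤ 3`).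

`C₁`, `C₂`, `C₃` are, respectively, the constants of the embedding
`‖u‖_{L⁴} ≤ C₁ ‖u‖_{H¹₀}`, of the embedding `‖·‖_{H⁻¹} ≤ C₂ ‖·‖_{L^{4/3}}`,
and of the Poincaré inequality `‖u‖_{L²} ≤ C₃ ‖u‖_{H¹₀}`.

`G`, `GV`, `Gc` are, respectively, `G_{H¹}`, `u ↦ G_{H¹}(V u)` and
`u ↦ G_{H¹}(|u|² u)`, characterized by their defining Riesz identities
(`Gc_bound` encodes `‖G_{H¹}(|u|²u)‖_{H¹₀} ≤ ‖u³‖_{H⁻¹} ≤ C₂ ‖u³‖_{L^{4/3}}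
= C₂ ‖u‖_{L⁴}³`).  `G0`, `G0c` are the analogous Green operators for the
`a₀`-inner product `(z,w)_{a₀} = ∫ ∇z·∇w + V z w`, and `Gau u` is the Green
operator for the `a_u`-inner product
`(z,w)_{a_u} = ∫ ∇z·∇w + V z w + β|u|² z w`. -/
structure GPSetting (H : Type*) [NormedAddCommGroup H] [InnerProductSpace ℝ H] where
  /-- the `L²(Ω)` inner product `(z,w)_{L²} = ∫ z w` on `H = H¹₀(Ω)` -/
  P : H →ₗ[ℝ] H →ₗ[ℝ] ℝ
  P_symm : ∀ z w : H, P z w = P w z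
  P_nonneg : ∀ z : H, 0 ≤ P z z
  P_definite : ∀ z : H, P z z = 0 → z = 0
  /-- `Vmax`, the (essential) upper bound of the potential `V` -/
  Vmax : ℝ
  Vmax_nonneg : 0 ≤ Vmax
  /-- the bilinear form `Vf z w = ∫ V z w` -/
  Vf : H →ₗ[ℝ] H →ₗ[ℝ] ℝ
  Vf_symm : ∀ z w : H, Vf z w = Vf w z
  Vf_nonneg : ∀ z : H, 0 ≤ Vf z z
  Vf_le : ∀ z : H, Vf z z ≤ Vmax * P z z
  /-- the interaction parameter `β ≥ 0` -/
  β : ℝ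
  β_nonneg : 0 ≤ β
  /-- the quadrilinear form `Q4 a b c d = ∫ a b c d` -/
  Q4 : H →ₗ[ℝ] H →ₗ[ℝ] H →ₗ[ℝ] H →ₗ[ℝ] ℝ
  Q4_symm₁ : ∀ a b c d : H, Q4 a b c d = Q4 b a c d
  Q4_symm₂ : ∀ a b c d : H, Q4 a b c d = Q4 a c b d
  Q4_symm₃ : ∀ a b c d : H, Q4 a b c d = Q4 a b d c
  Q4_sq_nonneg : ∀ z w : H, 0 ≤ Q4 z z w w
  /-- the constant of the Sobolev embedding `‖u‖_{L⁴} ≤ C₁ ‖u‖_{H¹₀}` -/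
  C₁ : ℝ
  C₁_pos : 0 < C₁
  embed_L4 : ∀ u : H, Q4 u u u u ≤ C₁ ^ 4 * ‖u‖ ^ 4
  /-- the constant of the embedding `‖·‖_{H⁻¹} ≤ C₂ ‖·‖_{L^{4/3}}` -/
  C₂ : ℝ
  C₂_pos : 0 < C₂
  /-- the Poincaré constant: `‖u‖_{L²} ≤ C₃ ‖u‖_{H¹₀}` -/
  C₃ : ℝ
  C₃_pos : 0 < C₃
  poincare : ∀ u : H, P u u ≤ C₃ ^ 2 * ‖u‖ ^ 2
  /-- the Green operator `G_{H¹}`: `(z, G_{H¹} w)_{H¹₀} = (z,w)_{L²}` -/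
  G : H →ₗ[ℝ] H
  G_def : ∀ z w : H, ⟪z, G w⟫ = P z w
  /-- `GV w = G_{H¹}(V w)`: `(z, G_{H¹}(Vw))_{H¹₀} = ∫ V z w` -/
  GV : H →ₗ[ℝ] H
  GV_def : ∀ z w : H, ⟪z, GV w⟫ = Vf z w
  /-- `Gc w = G_{H¹}(|w|² w)`: `(z, G_{H¹}(w³))_{H¹₀} = ∫ z w³` -/
  Gc : H → H
  Gc_def : ∀ z w : H, ⟪z, Gc w⟫ = Q4 z w w w
  Gc_bound : ∀ w : H, ‖Gc w‖ ≤ C₂ * (Q4 w w w w) ^ ((3 : ℝ) / 4)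
  /-- the Green operator `G_{a₀}`: `(z, G_{a₀} w)_{a₀} = (z,w)_{L²}` -/
  G0 : H →ₗ[ℝ] H
  G0_def : ∀ z w : H, ⟪z, G0 w⟫ + Vf z (G0 w) = P z w
  /-- `G0c w = G_{a₀}(|w|² w)` -/
  G0c : H → H
  G0c_def : ∀ z w : H, ⟪z, G0c w⟫ + Vf z (G0c w) = Q4 z w w w
  /-- the Green operator `G_{a_u}`: `(z, G_{a_u} w)_{a_u} = (z,w)_{L²}` -/
  Gau : H → H → H
  Gau_def : ∀ u z w : H,
    ⟪z, Gau u w⟫ + Vf z (Gau u w) + β * Q4 u u z (Gau u w) = P z w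

namespace GPSetting

variable {H : Type*} [NormedAddCommGroup H] [InnerProductSpace ℝ H] (S : GPSetting H)

/-- the `L²(Ω)` norm -/
noncomputable def l2norm (u : H) : ℝ := Real.sqrt (S.P u u)

/-- the `L⁴(Ω)` norm -/
noncomputable def l4norm (u : H) : ℝ := (S.Q4 u u u u) ^ ((1 : ℝ) / 4)

/-- the `H⁻¹(Ω)` (dual) norm of an element of `H¹₀(Ω)` -/
noncomputable def HnegNorm (u : H) : ℝ := ⨆ z : {z : H // ‖z‖ ≤ 1}, S.P z.1 u

/-- the manifold `M = {u ∈ H¹₀(Ω) : ‖u‖_{L²} = 1}` -/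
def Msphere : Set H := {u : H | S.P u u = 1}

/-- the Gross–Pitaevskii energy
`E(u) = ∫ (1/2)|∇u|² + (1/2)V|u|² + (β/4)|u|⁴` -/
noncomputable def energy (u : H) : ℝ :=
  (1 / 2) * ‖u‖ ^ 2 + (1 / 2) * S.Vf u u + (S.β / 4) * S.Q4 u u u u

/-- the retraction `R(u) = u / ‖u‖_{L²}` -/
noncomputable def retract (u : H) : H := (S.l2norm u)⁻¹ • u

/-- the `H¹`-gradient `∇_{H¹}E(u) = u + G_{H¹}(Vu + β|u|²u)` -/
noncomputable def gradH1 (u : H) : H := u + S.GV u + S.β • S.Gc u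

/-- the Riemannian `H¹`-gradient
`∇^R_{H¹}E(u) = ∇_{H¹}E(u) − ((∇_{H¹}E(u),u)_{L²}/‖G_{H¹}u‖²_{H¹₀}) G_{H¹}u` -/
noncomputable def gradRH1 (u : H) : H :=
  S.gradH1 u - (S.P (S.gradH1 u) u / ‖S.G u‖ ^ 2) • S.G u

/-- the `a₀`-inner product `(z,w)_{a₀} = ∫ ∇z·∇w + Vzw` -/
noncomputable def a0inner (z w : H) : ℝ := ⟪z, w⟫ + S.Vf z w

/-- the `a₀`-norm -/
noncomputable def a0norm (z : H) : ℝ := Real.sqrt (S.a0inner z z)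

/-- the `a₀`-gradient `∇_{a₀}E(u) = u + β G_{a₀}(|u|²u)` -/
noncomputable def gradA0 (u : H) : H := u + S.β • S.G0c u

/-- the Riemannian `a₀`-gradient
`∇^R_{a₀}E(u) = ∇_{a₀}E(u) − ((∇_{a₀}E(u),u)_{L²}/‖G_{a₀}u‖²_{a₀}) G_{a₀}u` -/
noncomputable def gradRA0 (u : H) : H :=
  S.gradA0 u - (S.P (S.gradA0 u) u / (S.a0norm (S.G0 u)) ^ 2) • S.G0 u

/-- the `a_u`-inner product `(z,w)_{a_u} = ∫ ∇z·∇w + Vzw + β|u|²zw` -/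
noncomputable def auinner (u z w : H) : ℝ :=
  ⟪z, w⟫ + S.Vf z w + S.β * S.Q4 u u z w

/-- the `a_u`-norm -/
noncomputable def aunorm (u z : H) : ℝ := Real.sqrt (S.auinner u z z)

/-- the Riemannian `a_u`-gradient
`∇^R_{a_u}E(u) = u − G_{a_u}u / ‖G_{a_u}u‖²_{a_u}` -/
noncomputable def gradRAu (u : H) : H :=
  u - ((S.aunorm u (S.Gau u u)) ^ 2)⁻¹ • S.Gau u u

/-- `ustar` is the ground state: the minimizer of `E` over `M`. -/
def IsGroundState (ustar : H) : Prop :=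
  ustar ∈ S.Msphere ∧ ∀ u ∈ S.Msphere, S.energy ustar ≤ S.energy u

/-- `lam0` and `lam1` are the smallest and second smallest eigenvalues of the
linearized problem `(−Δ + V + β|u*|²)u = λu` at the ground state `u*` (whose
bilinear form is the `a_{u*}`-inner product): `u*` is an eigenfunction for
`lam0`, `lam0` is a lower bound for the Rayleigh quotient, and `lam1` is a lower
bound for the Rayleigh quotient on the `L²`-orthogonal complement of `u*`. -/
def LinearizedEigs (ustar : H) (lam0 lam1 : ℝ) : Prop :=
  (∀ z : H, S.auinner ustar z ustar = lam0 * S.P z ustar) ∧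
  (∀ z : H, lam0 * S.P z z ≤ S.auinner ustar z z) ∧
  (∀ z : H, S.P z ustar = 0 → lam1 * S.P z z ≤ S.auinner ustar z z)

end GPSetting

namespace GPSetting

variable {H : Type*} [NormedAddCommGroup H] [InnerProductSpace ℝ H] (S : GPSetting H)

theorem a0inner_self_nonneg (z : H) : 0 ≤ S.a0inner z z :=
  add_nonneg real_inner_self_nonneg (S.Vf_nonneg z)

theorem a0norm_nonneg (z : H) : 0 ≤ S.a0norm z := Real.sqrt_nonneg _

theorem a0norm_sq (z : H) : S.a0norm z ^ 2 = S.a0inner z z :=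
  Real.sq_sqrt (S.a0inner_self_nonneg z)

theorem a0norm_sq_eq (z : H) : S.a0norm z ^ 2 = ‖z‖ ^ 2 + S.Vf z z := by
  rw [a0norm_sq, a0inner, real_inner_self_eq_norm_sq]

theorem norm_le_a0norm (z : H) : ‖z‖ ≤ S.a0norm z := by
  refine le_of_sq_le_sq ?_ (S.a0norm_nonneg z)
  rw [a0norm_sq_eq]
  linarith [S.Vf_nonneg z]

theorem a0inner_comm (z w : H) : S.a0inner z w = S.a0inner w z := by
  rw [a0inner, a0inner, real_inner_comm, S.Vf_symm]

theorem a0inner_add_right (z v w : H) :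
    S.a0inner z (v + w) = S.a0inner z v + S.a0inner z w := by
  simp only [a0inner, inner_add_right, map_add]
  ring

theorem a0inner_sub_right (z v w : H) :
    S.a0inner z (v - w) = S.a0inner z v - S.a0inner z w := by
  simp only [a0inner, inner_sub_right, map_sub]
  ring

theorem a0inner_smul_right (z w : H) (t : ℝ) :
    S.a0inner z (t • w) = t * S.a0inner z w := by
  simp only [a0inner, real_inner_smul_right, map_smul, smul_eq_mul]
  ring

theorem a0inner_G0 (z w : H) : S.a0inner z (S.G0 w) = S.P z w := S.G0_def z w

theorem a0inner_G0c (z w : H) : S.a0inner z (S.G0c w) = S.Q4 z w w w := S.G0c_def z w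

theorem Q4_add_self (z w : H) :
    S.Q4 (z + w) (z + w) (z + w) (z + w) =
      S.Q4 z z z z + 4 * S.Q4 w z z z + 6 * S.Q4 z z w w + 4 * S.Q4 z w w w + S.Q4 w w w w := by
  have h1 : S.Q4 z w z z = S.Q4 w z z z := S.Q4_symm₁ _ _ _ _
  have h2 : S.Q4 z z w z = S.Q4 w z z z := by rw [S.Q4_symm₂, h1]
  have h3 : S.Q4 z z z w = S.Q4 w z z z := by rw [S.Q4_symm₃, h2]
  have h4 : S.Q4 z w z w = S.Q4 z z w w := S.Q4_symm₂ _ _ _ _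
  have h5 : S.Q4 z w w z = S.Q4 z z w w := by rw [S.Q4_symm₃, h4]
  have h6 : S.Q4 w z z w = S.Q4 z z w w := by rw [S.Q4_symm₁, h4]
  have h7 : S.Q4 w z w z = S.Q4 z z w w := by rw [S.Q4_symm₃, h6]
  have h8 : S.Q4 w w z z = S.Q4 z z w w := by rw [S.Q4_symm₂, h7]
  have h9 : S.Q4 w z w w = S.Q4 z w w w := S.Q4_symm₁ _ _ _ _
  have h10 : S.Q4 w w z w = S.Q4 z w w w := by rw [S.Q4_symm₂, h9]
  have h11 : S.Q4 w w w z = S.Q4 z w w w := by rw [S.Q4_symm₃, h10]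
  simp only [map_add, LinearMap.add_apply]
  rw [h1, h2, h3, h4, h5, h6, h7, h8, h9, h10, h11]
  ring

theorem Q4_sub_smul_self (z w : H) (t : ℝ) :
    S.Q4 (z - t • w) (z - t • w) (z - t • w) (z - t • w) =
      S.Q4 z z z z - 4 * t * S.Q4 w z z z + 6 * t ^ 2 * S.Q4 z z w w
        - 4 * t ^ 3 * S.Q4 z w w w + t ^ 4 * S.Q4 w w w w := by
  rw [sub_eq_add_neg, ← neg_smul, Q4_add_self]
  simp only [map_smul, LinearMap.smul_apply, smul_eq_mul]
  ring

/-- A constant bounding the symmetric quadrilinear form in terms of its diagonal bound. -/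
noncomputable def quarticBound : ℝ := 2 * S.C₁ ^ 4

theorem quarticBound_nonneg : 0 ≤ S.quarticBound := by
  have := S.C₁_pos
  unfold quarticBound
  positivity

theorem Q4_self_le (z : H) : S.Q4 z z z z ≤ S.quarticBound * ‖z‖ ^ 4 := by
  have h := S.embed_L4 z
  have : 0 ≤ S.C₁ ^ 4 * ‖z‖ ^ 4 := by positivity
  unfold quarticBound
  linarith

theorem Q4_sq_le_sum (z w : H) :
    12 * S.Q4 z z w w ≤ S.C₁ ^ 4 * (4 * (‖z‖ ^ 2 + ‖w‖ ^ 2) ^ 2) := by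
  have hs := S.Q4_sub_smul_self z w 1
  rw [one_smul] at hs
  have hp := S.Q4_add_self z w
  have h1 := S.embed_L4 (z + w)
  have h2 := S.embed_L4 (z - w)
  have h3 : ‖z + w‖ ^ 2 + ‖z - w‖ ^ 2 = 2 * (‖z‖ ^ 2 + ‖w‖ ^ 2) := by
    linarith [parallelogram_law_with_norm ℝ z w]
  have h4 : ‖z + w‖ ^ 4 + ‖z - w‖ ^ 4 ≤ 4 * (‖z‖ ^ 2 + ‖w‖ ^ 2) ^ 2 := by
    calc ‖z + w‖ ^ 4 + ‖z - w‖ ^ 4 ≤ (‖z + w‖ ^ 2 + ‖z - w‖ ^ 2) ^ 2 := by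
          nlinarith [mul_nonneg (sq_nonneg ‖z + w‖) (sq_nonneg ‖z - w‖)]
      _ = 4 * (‖z‖ ^ 2 + ‖w‖ ^ 2) ^ 2 := by rw [h3]; ring
  have h5 := mul_le_mul_of_nonneg_left h4 (by positivity : 0 ≤ S.C₁ ^ 4)
  linarith [S.Q4_sq_nonneg z z, S.Q4_sq_nonneg w w]

theorem Q4_sq_le (z w : H) : S.Q4 z z w w ≤ S.quarticBound * (‖z‖ ^ 2 * ‖w‖ ^ 2) := by
  rcases eq_or_ne z 0 with rfl | hz
  · simp
  rcases eq_or_ne w 0 with rfl | hw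
  · simp
  have hz' : 0 < ‖z‖ := norm_pos_iff.2 hz
  have hw' : 0 < ‖w‖ := norm_pos_iff.2 hw
  have h := S.Q4_sq_le_sum (‖w‖ • z) (‖z‖ • w)
  simp only [map_smul, LinearMap.smul_apply, smul_eq_mul, norm_smul, norm_norm] at h
  have hpos : 0 < ‖z‖ ^ 2 * ‖w‖ ^ 2 := by positivity
  refine le_of_mul_le_mul_left ?_ hpos
  have : 0 ≤ S.C₁ ^ 4 * (‖z‖ ^ 2 * ‖w‖ ^ 2) ^ 2 := by positivity
  unfold quarticBound
  nlinarith

theorem Q4_mixed_sq_le (z w : H) :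
    S.Q4 z w w w ^ 2 ≤ S.Q4 z z w w * S.Q4 w w w w := by
  have hmix : ∀ a b : H, S.Q4 w w a b = S.Q4 w w b a := fun a b => S.Q4_symm₃ w w a b
  have h := LinearMap.BilinForm.apply_sq_le_of_symm (S.Q4 w w)
    (fun a => S.Q4_sq_nonneg w a) ⟨hmix⟩ z w
  have h1 : S.Q4 w w z w = S.Q4 z w w w := by rw [S.Q4_symm₂, S.Q4_symm₁]
  have h2 : S.Q4 w w z z = S.Q4 z z w w := by
    rw [S.Q4_symm₂, S.Q4_symm₁, S.Q4_symm₃, S.Q4_symm₂]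
  rwa [h1, h2] at h

theorem abs_Q4_mixed_le (z w : H) :
    |S.Q4 z w w w| ≤ S.quarticBound * (‖z‖ * ‖w‖ ^ 3) := by
  have hK := S.quarticBound_nonneg
  refine abs_le_of_sq_le_sq ?_ (by positivity)
  calc S.Q4 z w w w ^ 2 ≤ S.Q4 z z w w * S.Q4 w w w w := S.Q4_mixed_sq_le z w
    _ ≤ (S.quarticBound * (‖z‖ ^ 2 * ‖w‖ ^ 2)) * (S.quarticBound * ‖w‖ ^ 4) :=
        mul_le_mul (S.Q4_sq_le z w) (S.Q4_self_le w) (S.Q4_sq_nonneg w w) (by positivity)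
    _ = (S.quarticBound * (‖z‖ * ‖w‖ ^ 3)) ^ 2 := by ring

theorem abs_Q4_mixed_le_a0norm (z w : H) :
    |S.Q4 z w w w| ≤ S.quarticBound * (S.a0norm z * S.a0norm w ^ 3) := by
  have hK := S.quarticBound_nonneg
  have hz := S.norm_le_a0norm z
  have hw := S.norm_le_a0norm w
  have hz' := S.a0norm_nonneg z
  exact (S.abs_Q4_mixed_le z w).trans (by gcongr)

theorem Q4_sq_le_a0norm (z w : H) :
    S.Q4 z z w w ≤ S.quarticBound * (S.a0norm z ^ 2 * S.a0norm w ^ 2) := by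
  have hK := S.quarticBound_nonneg
  have hz := S.norm_le_a0norm z
  have hw := S.norm_le_a0norm w
  exact (S.Q4_sq_le z w).trans (by gcongr)

theorem a0norm_G0c_le (u : H) : S.a0norm (S.G0c u) ≤ S.quarticBound * S.a0norm u ^ 3 := by
  have hK := S.quarticBound_nonneg
  have hu := S.a0norm_nonneg u
  rcases (S.a0norm_nonneg (S.G0c u)).eq_or_lt with h0 | hpos
  · rw [← h0]; positivity
  have h := (le_abs_self _).trans (S.abs_Q4_mixed_le_a0norm (S.G0c u) u)
  rw [← a0inner_G0c, ← a0norm_sq] at h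
  refine le_of_mul_le_mul_left ?_ hpos
  linarith

theorem a0inner_gradA0 (z u : H) :
    S.a0inner z (S.gradA0 u) = S.a0inner z u + S.β * S.Q4 z u u u := by
  rw [gradA0, a0inner_add_right, a0inner_smul_right, a0inner_G0c]

theorem a0norm_gradA0_le (u : H) :
    S.a0norm (S.gradA0 u) ≤ S.a0norm u + S.β * (S.quarticBound * S.a0norm u ^ 3) := by
  have hK := S.quarticBound_nonneg
  have hβ := S.β_nonneg
  have hu := S.a0norm_nonneg u
  have hw := S.a0norm_nonneg (S.G0c u)
  have hG := S.a0norm_G0c_le u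
  have hQ := (le_abs_self _).trans (S.abs_Q4_mixed_le_a0norm u u)
  have hβQ := mul_le_mul_of_nonneg_left hQ hβ
  have hG2 : S.β ^ 2 * S.a0norm (S.G0c u) ^ 2 ≤
      S.β ^ 2 * (S.quarticBound * S.a0norm u ^ 3) ^ 2 := by gcongr
  refine le_of_sq_le_sq ?_ (by positivity)
  have hexp : S.a0norm (S.gradA0 u) ^ 2 =
      S.a0norm u ^ 2 + 2 * (S.β * S.Q4 u u u u) + S.β ^ 2 * S.a0norm (S.G0c u) ^ 2 := by
    rw [← a0inner_G0c, a0norm_sq, a0norm_sq, a0norm_sq, gradA0, a0inner_add_right,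
      a0inner_smul_right, S.a0inner_comm _ u, S.a0inner_comm _ (S.G0c u), a0inner_add_right,
      a0inner_add_right, a0inner_smul_right, a0inner_smul_right, S.a0inner_comm (S.G0c u) u]
    ring
  nlinarith

theorem P_G0_self (u : H) : S.P (S.G0 u) u = S.a0norm (S.G0 u) ^ 2 := by
  rw [a0norm_sq, a0inner_G0]

theorem a0norm_G0_ne_zero {u : H} (hu : u ∈ S.Msphere) : S.a0norm (S.G0 u) ≠ 0 := by
  intro h
  have h1 : S.G0 u = 0 := norm_le_zero_iff.1 ((S.norm_le_a0norm _).trans h.le)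
  have h2 := S.a0inner_G0 u u
  rw [h1, show S.P u u = 1 from hu] at h2
  simp [a0inner] at h2

theorem P_gradRA0 {u : H} (hu : u ∈ S.Msphere) : S.P (S.gradRA0 u) u = 0 := by
  have h := S.a0norm_G0_ne_zero hu
  rw [gradRA0, map_sub, map_smul, LinearMap.sub_apply, LinearMap.smul_apply, smul_eq_mul,
    P_G0_self]
  field_simp
  ring

theorem a0inner_gradRA0_gradA0 {u : H} (hu : u ∈ S.Msphere) :
    S.a0inner (S.gradRA0 u) (S.gradA0 u) = S.a0norm (S.gradRA0 u) ^ 2 := by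
  rw [a0norm_sq]
  nth_rewrite 3 [gradRA0]
  rw [a0inner_sub_right, a0inner_smul_right, a0inner_G0, S.P_gradRA0 hu, mul_zero, sub_zero]

theorem a0norm_gradRA0_le {u : H} (hu : u ∈ S.Msphere) :
    S.a0norm (S.gradRA0 u) ≤ S.a0norm (S.gradA0 u) := by
  refine le_of_sq_le_sq ?_ (S.a0norm_nonneg _)
  have h := S.a0inner_self_nonneg (S.gradA0 u - (1 : ℝ) • S.gradRA0 u)
  have h1 := S.a0inner_gradRA0_gradA0 hu
  rw [a0inner_sub_right, a0inner_smul_right, S.a0inner_comm _ (S.gradA0 u),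
    S.a0inner_comm _ (S.gradRA0 u), a0inner_sub_right, a0inner_sub_right,
    a0inner_smul_right, a0inner_smul_right, S.a0inner_comm (S.gradA0 u) (S.gradRA0 u),
    h1, ← a0norm_sq, ← a0norm_sq] at h
  linarith

theorem energy_eq (u : H) :
    S.energy u = 1 / 2 * S.a0norm u ^ 2 + S.β / 4 * S.Q4 u u u u := by
  rw [energy, a0norm_sq_eq]
  ring

theorem a0norm_sq_le_energy (u : H) : S.a0norm u ^ 2 ≤ 2 * S.energy u := by
  rw [energy_eq]
  linarith [mul_nonneg S.β_nonneg (S.Q4_sq_nonneg u u)]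

theorem a0norm_sq_sub_smul (u w : H) (t : ℝ) :
    S.a0norm (u - t • w) ^ 2 =
      S.a0norm u ^ 2 - 2 * t * S.a0inner w u + t ^ 2 * S.a0norm w ^ 2 := by
  rw [a0norm_sq, a0inner_sub_right, a0inner_smul_right, S.a0inner_comm _ u, S.a0inner_comm _ w,
    a0inner_sub_right, a0inner_sub_right, a0inner_smul_right, a0inner_smul_right,
    S.a0inner_comm u w, a0norm_sq, a0norm_sq]
  ring

theorem energy_sub_smul (u w : H) (t : ℝ) :
    S.energy (u - t • w) = S.energy u - t * S.a0inner w (S.gradA0 u)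
      + t ^ 2 / 2 * S.a0norm w ^ 2
      + S.β / 4 * (6 * t ^ 2 * S.Q4 u u w w - 4 * t ^ 3 * S.Q4 u w w w
        + t ^ 4 * S.Q4 w w w w) := by
  rw [energy_eq, energy_eq, a0norm_sq_sub_smul, Q4_sub_smul_self, a0inner_gradA0]
  ring

theorem energy_smul_le {t : ℝ} (ht0 : 0 ≤ t) (ht1 : t ≤ 1) (u : H) :
    S.energy (t • u) ≤ S.energy u := by
  have h2 : t ^ 2 ≤ 1 := pow_le_one₀ ht0 ht1
  have h4 : t ^ 4 ≤ 1 := pow_le_one₀ ht0 ht1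
  have hQ := mul_nonneg S.β_nonneg (S.Q4_sq_nonneg u u)
  have hV := S.Vf_nonneg u
  have hexp : S.energy (t • u) = t ^ 2 * (1 / 2 * ‖u‖ ^ 2 + 1 / 2 * S.Vf u u)
      + t ^ 4 * (S.β * S.Q4 u u u u / 4) := by
    simp only [energy, map_smul, LinearMap.smul_apply, smul_eq_mul, norm_smul, mul_pow,
      Real.norm_eq_abs, sq_abs]
    ring
  rw [hexp, energy]
  have e1 := mul_le_of_le_one_left (by positivity : 0 ≤ 1 / 2 * ‖u‖ ^ 2 + 1 / 2 * S.Vf u u) h2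
  have e2 := mul_le_of_le_one_left (by positivity : 0 ≤ S.β * S.Q4 u u u u / 4) h4
  linarith

theorem one_le_P_sub_smul_gradRA0 {u : H} (hu : u ∈ S.Msphere) (t : ℝ) :
    1 ≤ S.P (u - t • S.gradRA0 u) (u - t • S.gradRA0 u) := by
  have h1 := S.P_gradRA0 hu
  have h2 : S.P u (S.gradRA0 u) = 0 := by rw [S.P_symm, h1]
  have h3 := mul_nonneg (sq_nonneg t) (S.P_nonneg (S.gradRA0 u))
  simp only [map_sub, map_smul, LinearMap.sub_apply, LinearMap.smul_apply, smul_eq_mul, h1, h2,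
    show S.P u u = 1 from hu]
  linarith

theorem retract_mem_Msphere {v : H} (hv : 1 ≤ S.P v v) : S.retract v ∈ S.Msphere := by
  have h := Real.sq_sqrt (S.P_nonneg v)
  have hpos : 0 < √(S.P v v) := Real.sqrt_pos.2 (by linarith)
  change S.P ((S.l2norm v)⁻¹ • v) ((S.l2norm v)⁻¹ • v) = 1
  simp only [l2norm, map_smul, LinearMap.smul_apply, smul_eq_mul]
  field_simp
  exact h.symm

theorem energy_retract_le {v : H} (hv : 1 ≤ S.P v v) :
    S.energy (S.retract v) ≤ S.energy v :=
  S.energy_smul_le (inv_nonneg.2 (Real.sqrt_nonneg _))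
    (inv_le_one_of_one_le₀ (Real.one_le_sqrt.2 hv)) v

theorem energy_step {u : H} (hu : u ∈ S.Msphere) {A B t : ℝ} (hA : S.a0norm u ≤ A)
    (hB : S.a0norm (S.gradA0 u) ≤ B) (ht : 0 ≤ t)
    (ht' : t * (1 + S.β * S.quarticBound * (3 * A ^ 2 + 2 * A * B + B ^ 2)) ≤ 1) :
    t / 2 * S.a0norm (S.gradRA0 u) ^ 2 ≤
      S.energy u - S.energy (S.retract (u - t • S.gradRA0 u)) := by
  have hret := S.energy_retract_le (S.one_le_P_sub_smul_gradRA0 hu t)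
  rw [energy_sub_smul, S.a0inner_gradRA0_gradA0 hu] at hret
  have hN : S.a0norm (S.gradRA0 u) ≤ B := (S.a0norm_gradRA0_le hu).trans hB
  have q1 := S.Q4_sq_le_a0norm u (S.gradRA0 u)
  have q2 := (neg_le_abs _).trans (S.abs_Q4_mixed_le_a0norm u (S.gradRA0 u))
  have q3 := S.Q4_sq_le_a0norm (S.gradRA0 u) (S.gradRA0 u)
  have hK := S.quarticBound_nonneg
  have hβ := S.β_nonneg
  have hN0 := S.a0norm_nonneg (S.gradRA0 u)
  have hu0 := S.a0norm_nonneg u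
  set N := S.a0norm (S.gradRA0 u)
  set M := S.a0norm u
  set K := S.quarticBound
  have hA0 : 0 ≤ A := hu0.trans hA
  have hB0 : 0 ≤ B := hN0.trans hN
  have ht1 : t ≤ 1 := by
    have : 0 ≤ t * (S.β * K * (3 * A ^ 2 + 2 * A * B + B ^ 2)) := by positivity
    linarith
  have p1 : S.Q4 u u (S.gradRA0 u) (S.gradRA0 u) ≤ K * (A ^ 2 * N ^ 2) :=
    q1.trans (by gcongr)
  have p2 : -S.Q4 u (S.gradRA0 u) (S.gradRA0 u) (S.gradRA0 u) ≤ K * (A * B * N ^ 2) :=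
    q2.trans (by
      calc K * (M * N ^ 3) = K * (M * N * N ^ 2) := by ring
        _ ≤ K * (A * B * N ^ 2) := by gcongr)
  have p3 : S.Q4 (S.gradRA0 u) (S.gradRA0 u) (S.gradRA0 u) (S.gradRA0 u) ≤ K * (B ^ 2 * N ^ 2) :=
    q3.trans (by gcongr)
  have t3 : t ^ 3 ≤ t ^ 2 := pow_le_pow_of_le_one ht ht1 (by norm_num)
  have t4 : t ^ 4 ≤ t ^ 2 := pow_le_pow_of_le_one ht ht1 (by norm_num)
  have r1 := mul_le_mul_of_nonneg_left p1 (sq_nonneg t)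
  have r2 : t ^ 3 * -S.Q4 u (S.gradRA0 u) (S.gradRA0 u) (S.gradRA0 u) ≤
      t ^ 2 * (K * (A * B * N ^ 2)) :=
    (mul_le_mul_of_nonneg_left p2 (by positivity)).trans (by gcongr)
  have r3 : t ^ 4 * S.Q4 (S.gradRA0 u) (S.gradRA0 u) (S.gradRA0 u) (S.gradRA0 u) ≤
      t ^ 2 * (K * (B ^ 2 * N ^ 2)) :=
    (mul_le_mul_of_nonneg_left p3 (by positivity)).trans (by gcongr)
  have hsum : S.β / 4 * (6 * t ^ 2 * S.Q4 u u (S.gradRA0 u) (S.gradRA0 u)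
        - 4 * t ^ 3 * S.Q4 u (S.gradRA0 u) (S.gradRA0 u) (S.gradRA0 u)
        + t ^ 4 * S.Q4 (S.gradRA0 u) (S.gradRA0 u) (S.gradRA0 u) (S.gradRA0 u)) ≤
      S.β / 4 * (2 * (t ^ 2 * (K * ((3 * A ^ 2 + 2 * A * B + B ^ 2) * N ^ 2)))) := by
    refine mul_le_mul_of_nonneg_left ?_ (by positivity)
    have : 0 ≤ t ^ 2 * (K * (B ^ 2 * N ^ 2)) := by positivity
    linarith
  have hfin := mul_le_mul_of_nonneg_left ht' (by positivity : 0 ≤ t / 2 * N ^ 2)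
  linarith

theorem two_mul_energy_le (u : H) :
    2 * S.energy u ≤
      ‖u‖ ^ 2 + S.Vmax * (S.C₃ ^ 2 * ‖u‖ ^ 2) + S.β / 2 * (S.C₁ ^ 4 * ‖u‖ ^ 4) := by
  have h1 := (S.Vf_le u).trans (mul_le_mul_of_nonneg_left (S.poincare u) S.Vmax_nonneg)
  have h2 := mul_le_mul_of_nonneg_left (S.embed_L4 u) S.β_nonneg
  rw [energy]
  linarith

end GPSetting

/-- **Energy decay for the `a₀`-scheme** (Theorem `thm:energy_decay_a0`).
Given the norm `r = ‖u₀‖_{H¹₀}` of the initial point, there exist constants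
`Cu`, `Cg`, `Cα ≤ 1` (depending only on `Ω, d, β, V` — i.e. on the setting `S` —
and on `r`) such that for any `u₀ ∈ M` with `‖u₀‖ = r` and any stepsizes
`0 < αmin ≤ αₙ ≤ αmax ≤ Cα`, the iterates `u_{n+1} = R(uₙ − αₙ ∇^R_{a₀}E(uₙ))`
satisfy, for every `n`:
(i) `‖uₙ‖_{a₀} ≤ Cu`;
(ii) `‖∇^R_{a₀}E(uₙ)‖_{a₀} ≤ ‖∇_{a₀}E(uₙ)‖_{a₀} ≤ Cg`;
(iii) `E(uₙ) − E(u_{n+1}) ≥ (αmin/2)‖∇^R_{a₀}E(uₙ)‖²_{a₀}`. -/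
theorem energy_decay_a0
    {H : Type*} [NormedAddCommGroup H] [InnerProductSpace ℝ H]
    (S : GPSetting H) (r : ℝ) :
    ∃ Cu Cg Cα : ℝ, 0 < Cα ∧ Cα ≤ 1 ∧
      ∀ u₀ : H, u₀ ∈ S.Msphere → ‖u₀‖ = r →
        ∀ (αmin αmax : ℝ) (α : ℕ → ℝ),
          0 < αmin → (∀ n : ℕ, αmin ≤ α n ∧ α n ≤ αmax) → αmax ≤ Cα →
          ∀ u : ℕ → H, u 0 = u₀ →
            (∀ n : ℕ, u (n + 1) = S.retract (u n - α n • S.gradRA0 (u n))) →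
            ∀ n : ℕ,
              S.a0norm (u n) ≤ Cu ∧
              S.a0norm (S.gradRA0 (u n)) ≤ S.a0norm (S.gradA0 (u n)) ∧
              S.a0norm (S.gradA0 (u n)) ≤ Cg ∧
              αmin / 2 * (S.a0norm (S.gradRA0 (u n))) ^ 2 ≤
                S.energy (u n) - S.energy (u (n + 1)) := by
  set D : ℝ := r ^ 2 + S.Vmax * (S.C₃ ^ 2 * r ^ 2) + S.β / 2 * (S.C₁ ^ 4 * r ^ 4)
  set A : ℝ := √D
  set B : ℝ := A + S.β * (S.quarticBound * A ^ 3) with hB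
  have hK := S.quarticBound_nonneg
  have hβ := S.β_nonneg
  have hA0 : 0 ≤ A := Real.sqrt_nonneg _
  have hB0 : 0 ≤ B := by positivity
  set L : ℝ := 1 + S.β * S.quarticBound * (3 * A ^ 2 + 2 * A * B + B ^ 2)
  have hL1 : 1 ≤ L := le_add_of_nonneg_right (by positivity)
  have hL0 : 0 < L := by linarith
  refine ⟨A, B, L⁻¹, inv_pos.2 hL0, inv_le_one_of_one_le₀ hL1, ?_⟩
  intro u₀ hu₀ hr αmin αmax α hmin hα hmax u hu0 hstep
  have hstepsize : ∀ n, 0 ≤ α n ∧ α n * L ≤ 1 := fun n =>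
    ⟨hmin.le.trans (hα n).1,
      (le_div_iff₀ hL0).1 (by rw [one_div]; exact (hα n).2.trans hmax)⟩
  have hnorm : ∀ v : H, 2 * S.energy v ≤ D → S.a0norm v ≤ A := fun v hv =>
    Real.le_sqrt_of_sq_le ((S.a0norm_sq_le_energy v).trans hv)
  have hgrad : ∀ v : H, S.a0norm v ≤ A → S.a0norm (S.gradA0 v) ≤ B := fun v hv => by
    have h0 := S.a0norm_nonneg v
    exact (S.a0norm_gradA0_le v).trans (by rw [hB]; gcongr)
  have hdecay : ∀ n, u n ∈ S.Msphere → 2 * S.energy (u n) ≤ D →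
      α n / 2 * S.a0norm (S.gradRA0 (u n)) ^ 2 ≤ S.energy (u n) - S.energy (u (n + 1)) := by
    intro n hn hE
    rw [hstep n]
    exact S.energy_step hn (hnorm _ hE) (hgrad _ (hnorm _ hE)) (hstepsize n).1 (hstepsize n).2
  have hinv : ∀ n, u n ∈ S.Msphere ∧ 2 * S.energy (u n) ≤ D := by
    intro n
    induction n with
    | zero =>
      rw [hu0]
      refine ⟨hu₀, ?_⟩
      have h := S.two_mul_energy_le u₀
      rwa [hr] at h
    | succ n ih =>
      constructor
      · rw [hstep n]
        exact S.retract_mem_Msphere (S.one_le_P_sub_smul_gradRA0 ih.1 _)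
      · have h := hdecay n ih.1 ih.2
        have h0 : 0 ≤ α n / 2 * S.a0norm (S.gradRA0 (u n)) ^ 2 :=
          mul_nonneg (by linarith [(hstepsize n).1]) (sq_nonneg _)
        linarith [ih.2]
  intro n
  obtain ⟨hM, hE⟩ := hinv n
  refine ⟨hnorm _ hE, S.a0norm_gradRA0_le hM, hgrad _ (hnorm _ hE), ?_⟩
  refine le_trans ?_ (hdecay n hM hE)
  have := (hα n).1
  gcongr
end

section
/- For all u, v ∈ H^1_0(Ω), |E(u+v) − E(u) − (∇_{H¹}E(u), v)_{H^1_0(Ω)}| ≤ ((1 + C₃²V_max)/2)‖v‖²_{H^1_0(Ω)} + (3βC₁⁴/2)‖u‖²_{H^1_0(Ω)}‖v‖²_{H^1_0(Ω)} + βC₁⁴‖u‖_{H^1_0(Ω)}‖v‖³_{H^1_0(Ω)} + (βC₁⁴/4)‖v‖⁴_{H^1_0(Ω)}. -/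
open scoped RealInnerProductSpace
open Filter Topology

namespace GPSetting

variable {H : Type*} [NormedAddCommGroup H] [InnerProductSpace ℝ H] (S : GPSetting H)

lemma Q4_add_smul_sq_sq (a b : H) (s t : ℝ) :
    S.Q4 (a + s • b) (a + s • b) (a + t • b) (a + t • b) =
      S.Q4 a a a a + 2 * (s + t) * S.Q4 a a a b +
        (s ^ 2 + 4 * s * t + t ^ 2) * S.Q4 a a b b +
        2 * s * t * (s + t) * S.Q4 a b b b + s ^ 2 * t ^ 2 * S.Q4 b b b b := by
  have e1 : S.Q4 a a b a = S.Q4 a a a b := S.Q4_symm₃ ..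
  have e2 : S.Q4 a b a a = S.Q4 a a a b := (S.Q4_symm₂ ..).trans e1
  have e3 : S.Q4 b a a a = S.Q4 a a a b := (S.Q4_symm₁ ..).trans e2
  have f1 : S.Q4 a b a b = S.Q4 a a b b := S.Q4_symm₂ ..
  have f2 : S.Q4 a b b a = S.Q4 a a b b := (S.Q4_symm₃ ..).trans f1
  have f3 : S.Q4 b a a b = S.Q4 a a b b := (S.Q4_symm₁ ..).trans f1
  have f4 : S.Q4 b a b a = S.Q4 a a b b := (S.Q4_symm₁ ..).trans f2
  have f5 : S.Q4 b b a a = S.Q4 a a b b := (S.Q4_symm₂ ..).trans f4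
  have g1 : S.Q4 b a b b = S.Q4 a b b b := S.Q4_symm₁ ..
  have g2 : S.Q4 b b a b = S.Q4 a b b b := (S.Q4_symm₂ ..).trans g1
  have g3 : S.Q4 b b b a = S.Q4 a b b b := (S.Q4_symm₃ ..).trans g2
  simp only [map_add, map_smul, LinearMap.add_apply, LinearMap.smul_apply, smul_eq_mul,
    e1, e2, e3, f1, f2, f3, f4, f5, g1, g2, g3]
  ring

lemma Q4_sq_sub_sq_nonneg (a b : H) :
    0 ≤ S.Q4 a a a a - 2 * S.Q4 a a b b + S.Q4 b b b b := by
  have h := S.Q4_sq_nonneg (a + (1 : ℝ) • b) (a + (-1 : ℝ) • b)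
  rw [S.Q4_add_smul_sq_sq] at h
  linarith

/-- Cauchy–Schwarz for the squares of two functions. -/
lemma Q4_sq_sq_le (a b : H) :
    S.Q4 a a b b ^ 2 ≤ S.Q4 a a a a * S.Q4 b b b b := by
  have hq : ∀ x : ℝ, 0 ≤ S.Q4 a a a a * (x * x) + (-2 * S.Q4 a a b b) * x + S.Q4 b b b b := by
    intro x
    rcases le_total 0 x with hx | hx
    · have h := S.Q4_sq_sub_sq_nonneg (√x • a) b
      simp only [map_smul, LinearMap.smul_apply, smul_eq_mul] at h
      have hs := Real.mul_self_sqrt hx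
      calc (0 : ℝ) ≤ _ := h
        _ = S.Q4 a a a a * ((√x * √x) * (√x * √x)) + (-2 * S.Q4 a a b b) * (√x * √x) +
            S.Q4 b b b b := by ring
        _ = _ := by rw [hs]
    · have := mul_nonneg (S.Q4_sq_nonneg a a) (mul_self_nonneg x)
      nlinarith [mul_nonneg (S.Q4_sq_nonneg a b) (neg_nonneg.2 hx), S.Q4_sq_nonneg b b]
  have h := discrim_le_zero hq
  rw [discrim] at h
  linarith

/-- Cauchy–Schwarz for the positive semidefinite form `(a, c) ↦ Q4 a c b b` at `c = b`. -/
lemma Q4_cube_sq_le (a b : H) :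
    S.Q4 a b b b ^ 2 ≤ S.Q4 a a b b * S.Q4 b b b b := by
  have hq : ∀ x : ℝ, 0 ≤ S.Q4 b b b b * (x * x) + (2 * S.Q4 a b b b) * x + S.Q4 a a b b := by
    intro x
    have h := S.Q4_sq_nonneg (a + x • b) b
    simp only [map_add, map_smul, LinearMap.add_apply, LinearMap.smul_apply, smul_eq_mul,
      S.Q4_symm₁ b a b b] at h
    linarith
  have h := discrim_le_zero hq
  rw [discrim] at h
  linarith

lemma Q4_sq_sq_le_norm (a b : H) :
    S.Q4 a a b b ≤ S.C₁ ^ 4 * ‖a‖ ^ 2 * ‖b‖ ^ 2 := by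
  refine le_of_sq_le_sq ?_ (by positivity)
  calc S.Q4 a a b b ^ 2 ≤ S.Q4 a a a a * S.Q4 b b b b := S.Q4_sq_sq_le a b
    _ ≤ (S.C₁ ^ 4 * ‖a‖ ^ 4) * (S.C₁ ^ 4 * ‖b‖ ^ 4) :=
      mul_le_mul (S.embed_L4 a) (S.embed_L4 b) (S.Q4_sq_nonneg b b) (by positivity)
    _ = (S.C₁ ^ 4 * ‖a‖ ^ 2 * ‖b‖ ^ 2) ^ 2 := by ring

lemma abs_Q4_cube_le_norm (a b : H) :
    |S.Q4 a b b b| ≤ S.C₁ ^ 4 * ‖a‖ * ‖b‖ ^ 3 := by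
  refine abs_le_of_sq_le_sq ?_ (by positivity)
  calc S.Q4 a b b b ^ 2 ≤ S.Q4 a a b b * S.Q4 b b b b := S.Q4_cube_sq_le a b
    _ ≤ (S.C₁ ^ 4 * ‖a‖ ^ 2 * ‖b‖ ^ 2) * (S.C₁ ^ 4 * ‖b‖ ^ 4) :=
      mul_le_mul (S.Q4_sq_sq_le_norm a b) (S.embed_L4 b) (S.Q4_sq_nonneg b b) (by positivity)
    _ = (S.C₁ ^ 4 * ‖a‖ * ‖b‖ ^ 3) ^ 2 := by ring

lemma Vf_le_norm (v : H) : S.Vf v v ≤ S.C₃ ^ 2 * S.Vmax * ‖v‖ ^ 2 := by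
  calc S.Vf v v ≤ S.Vmax * S.P v v := S.Vf_le v
    _ ≤ S.Vmax * (S.C₃ ^ 2 * ‖v‖ ^ 2) :=
      mul_le_mul_of_nonneg_left (S.poincare v) S.Vmax_nonneg
    _ = S.C₃ ^ 2 * S.Vmax * ‖v‖ ^ 2 := by ring

lemma inner_gradH1 (u v : H) :
    ⟪S.gradH1 u, v⟫ = ⟪u, v⟫ + S.Vf u v + S.β * S.Q4 u u u v := by
  have h : S.Q4 v u u u = S.Q4 u u u v := by
    rw [S.Q4_symm₁, S.Q4_symm₂, S.Q4_symm₃]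
  rw [gradH1, inner_add_left, inner_add_left, real_inner_smul_left,
    real_inner_comm v (S.GV u), real_inner_comm v (S.Gc u), S.GV_def, S.Gc_def, h, S.Vf_symm v u]

/-- The exact second-order Taylor remainder of the energy. -/
lemma energy_add_sub_inner_gradH1 (u v : H) :
    S.energy (u + v) - S.energy u - ⟪S.gradH1 u, v⟫ =
      1 / 2 * ‖v‖ ^ 2 + 1 / 2 * S.Vf v v +
        S.β / 4 * (6 * S.Q4 u u v v + 4 * S.Q4 u v v v + S.Q4 v v v v) := by
  have h := S.Q4_add_smul_sq_sq u v 1 1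
  simp only [one_smul] at h
  rw [S.inner_gradH1, energy, energy, h, norm_add_sq_real]
  simp only [map_add, LinearMap.add_apply, S.Vf_symm v u]
  ring

end GPSetting

/-- **Linearization error of the energy** (Lemma `lem:linear_error`).
For all `u, v ∈ H¹₀(Ω)`,
`|E(u+v) − E(u) − (∇_{H¹}E(u), v)_{H¹₀}|
  ≤ ((1 + C₃²Vmax)/2)‖v‖² + (3βC₁⁴/2)‖u‖²‖v‖² + βC₁⁴‖u‖‖v‖³ + (βC₁⁴/4)‖v‖⁴`,
all norms being `H¹₀`-norms. -/
theorem energy_linearization_error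
    {H : Type*} [NormedAddCommGroup H] [InnerProductSpace ℝ H]
    (S : GPSetting H) (u v : H) :
    |S.energy (u + v) - S.energy u - ⟪S.gradH1 u, v⟫| ≤
      (1 + S.C₃ ^ 2 * S.Vmax) / 2 * ‖v‖ ^ 2 +
      3 * S.β * S.C₁ ^ 4 / 2 * ‖u‖ ^ 2 * ‖v‖ ^ 2 +
      S.β * S.C₁ ^ 4 * ‖u‖ * ‖v‖ ^ 3 +
      S.β * S.C₁ ^ 4 / 4 * ‖v‖ ^ 4 := by
  rw [S.energy_add_sub_inner_gradH1]
  have hD := abs_le.1 (S.abs_Q4_cube_le_norm u v)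
  have hβ := S.β_nonneg
  have b1 := mul_le_mul_of_nonneg_left (S.Q4_sq_sq_le_norm u v) hβ
  have b2 := mul_le_mul_of_nonneg_left hD.2 hβ
  have b3 := mul_le_mul_of_nonneg_left hD.1 hβ
  have b4 := mul_le_mul_of_nonneg_left (S.embed_L4 v) hβ
  have n1 := mul_nonneg hβ (S.Q4_sq_nonneg u v)
  have n2 := mul_nonneg hβ (S.Q4_sq_nonneg v v)
  have hV := S.Vf_le_norm v
  have hV0 := S.Vf_nonneg v
  have hv := sq_nonneg ‖v‖
  rw [abs_le]
  constructor <;> linarith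
end
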